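/- Let u = (u_1, …, u_p) and b = (b_1, …, b_y) be nonincreasing sequences of integers with y ≥ 1, and let v = (v_1, …, v_{p+y}) be the nonincreasing rearrangement of the concatenation of u and b. For 1 ≤ j ≤ y set k_j = min{ i : b_j > u_i } (which exists and satisfies 1 ≤ k_j ≤ p+1 under the convention u_i = −∞ for i > p), and set h_j = min{ i : u_{i−j+1} < v_i } (under the conventions u_i = +∞ for i < 1 and u_i = −∞ for i > p). Then for every 1 ≤ j ≤ y one has h_j = k_j + j − 1 and Σ_{i=1}^{h_j} v_i = Σ_{i=1}^{j} b_i + Σ_{i=1}^{h_j − j} u_i. -/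

import Mathlib

/-- Index `h_j = min{ i : u_{i-j+1} < v_i }`, with the conventions `u_i = +∞`
for `i < 1` (hence `j ≤ i`) and `u_i = -∞` for `i > p` (hence the disjunct
`p < i - j + 1`). -/
noncomputable def hIdx (p : ℕ) (u v : ℕ → ℤ) (j : ℕ) : ℕ :=
  sInf {i : ℕ | j ≤ i ∧ (p < i - j + 1 ∨ u (i - j + 1) < v i)}

/-- The set `{ i : b_j > u_i }` (for `i ≥ 1`), with the convention `u_i = -∞`
for `i > p` (hence the disjunct `p < i`). -/
def kSet (p : ℕ) (u : ℕ → ℤ) (bj : ℤ) : Set ℕ :=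
  {i : ℕ | 1 ≤ i ∧ (p < i ∨ u i < bj)}

/-!
STATEMENT 4: Let u = (u_1, …, u_p) and b = (b_1, …, b_y) be nonincreasing
sequences of integers with y ≥ 1, and let v = (v_1, …, v_{p+y}) be the
nonincreasing rearrangement of the concatenation of u and b.  For 1 ≤ j ≤ y set
k_j = min{ i : b_j > u_i } (which exists and satisfies 1 ≤ k_j ≤ p+1 under the
convention u_i = −∞ for i > p), and set h_j = min{ i : u_{i−j+1} < v_i }
(under the conventions u_i = +∞ for i < 1 and u_i = −∞ for i > p).  Then for
every 1 ≤ j ≤ y one has h_j = k_j + j − 1 and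
Σ_{i=1}^{h_j} v_i = Σ_{i=1}^{j} b_i + Σ_{i=1}^{h_j − j} u_i.
-/

open Classical in
theorem aux_lower (n m : ℕ) (w : ℕ → ℤ) (P : ℤ → Prop) (hm : m ≤ n)
    (h : ∀ i, 1 ≤ i → i ≤ m → P (w i)) :
    m ≤ ((Finset.Icc 1 n).filter (fun i => P (w i))).card := by
  calc m = (Finset.Icc 1 m).card := by simp
    _ ≤ _ := by
      apply Finset.card_le_card
      intro i hi
      simp only [Finset.mem_Icc, Finset.mem_filter] at hi ⊢
      exact ⟨⟨hi.1, hi.2.trans hm⟩, h i hi.1 hi.2⟩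

open Classical in
theorem aux_upper (n m : ℕ) (w : ℕ → ℤ) (P : ℤ → Prop)
    (h : ∀ i, 1 ≤ i → m < i → i ≤ n → ¬ P (w i)) :
    ((Finset.Icc 1 n).filter (fun i => P (w i))).card ≤ m := by
  calc _ ≤ (Finset.Icc 1 m).card := by
        apply Finset.card_le_card
        intro i hi
        simp only [Finset.mem_Icc, Finset.mem_filter] at hi ⊢
        refine ⟨hi.1.1, ?_⟩
        by_contra hc
        exact h i hi.1.1 (by omega) hi.1.2 hi.2
    _ = m := by simp

theorem aux_pos (n m : ℕ) (w : ℕ → ℤ) (c : ℤ) (hm : m ≤ n)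
    (h1 : ∀ i, 1 ≤ i → i ≤ m → c ≤ w i)
    (h2 : ∀ i, m < i → i ≤ n → w i ≤ c) :
    ∑ i ∈ Finset.Icc 1 n, max (w i - c) 0 = ∑ i ∈ Finset.Icc 1 m, w i - m * c := by
  have hsub : Finset.Icc 1 m ⊆ Finset.Icc 1 n := Finset.Icc_subset_Icc le_rfl hm
  rw [← Finset.sum_subset hsub]
  · rw [Finset.sum_congr rfl (g := fun i => w i - c)]
    · simp
    · intro i hi
      simp only [Finset.mem_Icc] at hi
      have := h1 i hi.1 hi.2
      omega
  · intro i hi hi'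
    simp only [Finset.mem_Icc] at hi hi'
    have := h2 i (by omega) hi.2
    omega

theorem stmt4 (p y : ℕ) (hy : 1 ≤ y) (u b v : ℕ → ℤ)
    (hu : ∀ i j, 1 ≤ i → i ≤ j → j ≤ p → u j ≤ u i)
    (hb : ∀ i j, 1 ≤ i → i ≤ j → j ≤ y → b j ≤ b i)
    (hv : ∀ i j, 1 ≤ i → i ≤ j → j ≤ p + y → v j ≤ v i)
    (hperm : (Finset.Icc 1 (p + y)).val.map v
      = (Finset.Icc 1 p).val.map u + (Finset.Icc 1 y).val.map b) :
    ∀ j, 1 ≤ j → j ≤ y →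
      (kSet p u (b j)).Nonempty ∧
      1 ≤ sInf (kSet p u (b j)) ∧ sInf (kSet p u (b j)) ≤ p + 1 ∧
      hIdx p u v j = sInf (kSet p u (b j)) + j - 1 ∧
      (∑ i ∈ Finset.Icc 1 (hIdx p u v j), v i)
        = (∑ i ∈ Finset.Icc 1 j, b i) + ∑ i ∈ Finset.Icc 1 (hIdx p u v j - j), u i := by
  intro j hj1 hjy
  classical
  have hS : ∀ f : ℤ → ℤ, ∑ i ∈ Finset.Icc 1 (p + y), f (v i)
      = ∑ i ∈ Finset.Icc 1 p, f (u i) + ∑ i ∈ Finset.Icc 1 y, f (b i) := by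
    intro f
    have := congrArg (fun s : Multiset ℤ => (s.map f).sum) hperm
    simp only [Multiset.map_add, Multiset.sum_add, Multiset.map_map] at this
    exact this
  have hC : ∀ P : ℤ → Prop, ((Finset.Icc 1 (p + y)).filter (fun i => P (v i))).card
      = ((Finset.Icc 1 p).filter (fun i => P (u i))).card
        + ((Finset.Icc 1 y).filter (fun i => P (b i))).card := by
    intro P
    have := hS (fun x => if P x then 1 else 0)
    simp only [Finset.sum_boole] at this
    exact_mod_cast this
  have hmem : p + 1 ∈ kSet p u (b j) := ⟨by omega, Or.inl (by omega)⟩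
  have hne : (kSet p u (b j)).Nonempty := ⟨_, hmem⟩
  have hk := Nat.sInf_mem hne
  have hkp : sInf (kSet p u (b j)) ≤ p + 1 := Nat.sInf_le hmem
  have hkl : ∀ i, 1 ≤ i → i < sInf (kSet p u (b j)) → i ≤ p ∧ b j ≤ u i := by
    intro i hi hik
    have := Nat.notMem_of_lt_sInf hik
    simp only [kSet, Set.mem_ofPred_eq, not_and, not_or, not_lt] at this
    exact this hi
  generalize sInf (kSet p u (b j)) = k at hk hkp hkl ⊢
  obtain ⟨hk1, hk2⟩ := hk
  have hku : ∀ i, k ≤ i → i ≤ p → u i < b j := by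
    intro i hi hip
    rcases hk2 with h | h
    · omega
    · exact lt_of_le_of_lt (hu k i hk1 hi hip) h
  -- the top block of v
  have hvh : b j ≤ v (k + j - 1) := by
    by_contra hc
    have e := hC (fun x => b j ≤ x)
    have a1 := aux_lower p (k - 1) u (fun x => b j ≤ x) (by omega)
      (fun i h1 h2 => (hkl i h1 (by omega)).2)
    have a2 := aux_lower y j b (fun x => b j ≤ x) hjy (fun i h1 h2 => hb i j h1 h2 hjy)
    have a3 := aux_upper (p + y) (k + j - 2) v (fun x => b j ≤ x) (by
      intro i h1 h2 h3
      have := hv (k + j - 1) i (by omega) (by omega) h3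
      omega)
    omega
  have hvl : ∀ i, k + j - 1 < i → i ≤ p + y → v i ≤ b j := by
    intro i hi hip
    by_contra hc
    have e := hC (fun x => b j < x)
    have a1 := aux_upper p (k - 1) u (fun x => b j < x) (by
      intro i h1 h2 h3
      have := hku i (by omega) h3
      omega)
    have a2 := aux_upper y j b (fun x => b j < x) (by
      intro i h1 h2 h3
      have := hb j i hj1 h2.le h3
      omega)
    have a3 := aux_lower (p + y) i v (fun x => b j < x) hip (by
      intro l h1 h2
      have := hv l i h1 h2 hip
      omega)
    omega
  have hh : hIdx p u v j = k + j - 1 := by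
    apply IsLeast.csInf_eq
    constructor
    · refine ⟨by omega, ?_⟩
      have e : k + j - 1 - j + 1 = k := by omega
      rw [e]
      rcases hk2 with h | h
      · exact Or.inl h
      · exact Or.inr (lt_of_lt_of_le h hvh)
    · rintro i ⟨hji, hi⟩
      by_contra hc
      obtain ⟨hp1, hp2⟩ := hkl (i - j + 1) (by omega) (by omega)
      have hi' : u (i - j + 1) < v i := by
        rcases hi with h | h
        · omega
        · exact h
      have e := hC (fun x => u (i - j + 1) < x)
      have a1 := aux_upper p (i - j) u (fun x => u (i - j + 1) < x) (by
        intro l h1 h2 h3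
        have := hu (i - j + 1) l (by omega) (by omega) h3
        omega)
      have a2 := aux_upper y (j - 1) b (fun x => u (i - j + 1) < x) (by
        intro l h1 h2 h3
        have := hb j l hj1 (by omega) h3
        omega)
      have a3 := aux_lower (p + y) i v (fun x => u (i - j + 1) < x) (by omega) (by
        intro l h1 h2
        have := hv l i h1 h2 (by omega)
        omega)
      omega
  refine ⟨hne, hk1, hkp, hh, ?_⟩
  rw [hh]
  have e := hS (fun x => max (x - b j) 0)
  rw [aux_pos (p + y) (k + j - 1) v (b j) (by omega)
      (fun i h1 h2 => hvh.trans (hv i _ h1 h2 (by omega))) hvl,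
    aux_pos p (k - 1) u (b j) (by omega) (fun i h1 h2 => (hkl i h1 (by omega)).2)
      (fun i h1 h2 => (hku i (by omega) h2).le),
    aux_pos y j b (b j) hjy (fun i h1 h2 => hb i j h1 h2 hjy)
      (fun i h1 h2 => hb j i hj1 h1.le h2)] at e
  have e1 : k + j - 1 - j = k - 1 := by omega
  have e2 : ((k + j - 1 : ℕ) : ℤ) = ((k - 1 : ℕ) : ℤ) + (j : ℤ) := by omega
  rw [e1]
  rw [e2] at e
  linarith
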